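/- arXiv:2510.26264 — 3 statements merged into one kernel-verified Lean document; each statement's English description precedes it below -/
import Mathlib

section
/- Let T be a string of length n and let T[a..b) be a fragment with p := per(T[a..b)) satisfying 2p ≤ b−a. Then there exists exactly one run T[x..y] of T with smallest period p such that x ≤ a and b−1 ≤ y; that is, every periodic fragment of T extends uniquely to a run of T with the same smallest period. -/
/-- The unique position `b ∈ [i .. i+p)` with `p ∣ (b - a)` (congruent to `a` mod `p`). -/
def projPos (i p a : ℕ) : ℕ := i + ((a % p + p - i % p) % p)

/-- Hamming distance of two length-`n` strings (given as functions `ℕ → α`). -/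
def hammingN {α : Type*} [DecidableEq α] (n : ℕ) (U V : ℕ → α) : ℕ :=
  ((Finset.range n).filter fun a => U a ≠ V a).card

/-- Misperiods of `S` (of length `n`) with respect to the fragment `S[i..j)`. -/
def misperiods {α : Type*} [DecidableEq α] (n : ℕ) (S : ℕ → α) (i j : ℕ) : Finset ℕ :=
  (Finset.range n).filter fun a => S a ≠ S (projPos i (j - i) a)

/-- The (at most) `k` largest elements of a finite set of naturals. -/
def topK (k : ℕ) (M : Finset ℕ) : Finset ℕ :=
  M.filter fun a => (M.filter fun b => a ≤ b).card ≤ k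

/-- The (at most) `k` smallest elements of a finite set of naturals. -/
def botK (k : ℕ) (M : Finset ℕ) : Finset ℕ :=
  M.filter fun a => (M.filter fun b => b ≤ a).card ≤ k

/-- `Misper_k(S,i,j)`: the `k` largest misperiods smaller than `i` together with the
`k` smallest misperiods that are at least `j`. -/
def misperK {α : Type*} [DecidableEq α] (k n : ℕ) (S : ℕ → α) (i j : ℕ) : Finset ℕ :=
  topK k ((misperiods n S i j).filter fun a => a < i) ∪
  botK k ((misperiods n S i j).filter fun a => j ≤ a)

/-- `Misper(S,i,j) = Misper_{|S|}(S,i,j)`. -/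
def misperAll {α : Type*} [DecidableEq α] (n : ℕ) (S : ℕ → α) (i j : ℕ) : Finset ℕ :=
  misperK n n S i j

/-- `p` is a period of the length-`len` fragment of `S` starting at position `x`. -/
def IsPeriod {α : Type*} (S : ℕ → α) (x len p : ℕ) : Prop :=
  1 ≤ p ∧ p ≤ len ∧ ∀ a, a + p < len → S (x + a) = S (x + a + p)

/-- `per`: the smallest period of the length-`len` fragment of `S` starting at `x`. -/
noncomputable def perOf {α : Type*} (S : ℕ → α) (x len : ℕ) : ℕ :=
  sInf {p | IsPeriod S x len p}

/-- `T[x..y]` is a run of the length-`n` string `T`. -/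
def IsRun {α : Type*} (n : ℕ) (T : ℕ → α) (x y : ℕ) : Prop :=
  x ≤ y ∧ y < n ∧
  2 * perOf T x (y - x + 1) ≤ y - x + 1 ∧
  (x = 0 ∨ T (x - 1) ≠ T (x - 1 + perOf T x (y - x + 1))) ∧
  (y = n - 1 ∨ T (y + 1) ≠ T (y + 1 - perOf T x (y - x + 1)))

/-- `T[x..y]` is a `τ`-run: a run of length at least `3τ - 1` and period at most `τ/3`. -/
def IsTauRun {α : Type*} (n : ℕ) (T : ℕ → α) (τ x y : ℕ) : Prop :=
  IsRun n T x y ∧ 3 * τ ≤ y - x + 2 ∧ 3 * perOf T x (y - x + 1) ≤ τ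

/-- `A` is a `τ`-synchronizing set of the length-`n` string `T`. -/
def IsSyncSet {α : Type*} (n τ : ℕ) (T : ℕ → α) (A : Finset ℕ) : Prop :=
  (∀ a ∈ A, a + 2 * τ ≤ n) ∧
  (∀ i j : ℕ, i + 2 * τ ≤ n → j + 2 * τ ≤ n →
      (∀ d < 2 * τ, T (i + d) = T (j + d)) → (i ∈ A ↔ j ∈ A)) ∧
  (∀ i : ℕ, i + 3 * τ ≤ n + 1 →
      ((∀ d < τ, i + d ∉ A) ↔ 3 * perOf T i (3 * τ - 1) ≤ τ))

/-- The fragment `P[x..x+len)` occurs in the length-`n` string `T`. -/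
def OccursIn {α : Type*} (n : ℕ) (T : ℕ → α) (P : ℕ → α) (x len : ℕ) : Prop :=
  ∃ s, s + len ≤ n ∧ ∀ d < len, T (s + d) = P (x + d)

theorem IsPeriod.isPeriod_perOf {α : Type*} {S : ℕ → α} {x len p : ℕ}
    (h : IsPeriod S x len p) : IsPeriod S x len (perOf S x len) :=
  Nat.sInf_mem (s := {p | IsPeriod S x len p}) ⟨p, h⟩

theorem IsPeriod.perOf_le {α : Type*} {S : ℕ → α} {x len p : ℕ}
    (h : IsPeriod S x len p) : perOf S x len ≤ p :=
  Nat.sInf_le (s := {p | IsPeriod S x len p}) h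

/-- A nonempty fragment has its own length as a period. -/
theorem isPeriod_length {α : Type*} (S : ℕ → α) (x : ℕ) {len : ℕ} (h : 1 ≤ len) :
    IsPeriod S x len len :=
  ⟨h, le_rfl, fun _ hi => by omega⟩

theorem IsPeriod.eq_add {α : Type*} {S : ℕ → α} {x len p i : ℕ}
    (h : IsPeriod S x len p) (hxi : x ≤ i) (hi : i + p < x + len) : S i = S (i + p) := by
  have := h.2.2 (i - x) (by omega)
  rwa [Nat.add_sub_cancel' hxi] at this

/-- If a period of a fragment is the smallest period of some subfragment, then it is the
smallest period of the whole fragment. -/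
theorem IsPeriod.perOf_eq_of_subfragment {α : Type*} {S : ℕ → α} {x len a l : ℕ} (hl : 1 ≤ l)
    (hxa : x ≤ a) (hal : a + l ≤ x + len) (h : IsPeriod S x len (perOf S a l)) :
    perOf S x len = perOf S a l := by
  refine le_antisymm h.perOf_le (IsPeriod.perOf_le ?_)
  have hq := h.isPeriod_perOf
  have hp := (isPeriod_length S a hl).isPeriod_perOf
  exact ⟨hq.1, h.perOf_le.trans hp.2.1, fun i hi => hq.eq_add (by omega) (by omega)⟩

/-- A `p`-periodic stretch ending before `b` can be extended maximally to the left. -/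
theorem exists_left_maximal {α : Type*} (T : ℕ → α) (p a b : ℕ)
    (h : ∀ i, a ≤ i → i + p < b → T i = T (i + p)) :
    ∃ x ≤ a, (∀ i, x ≤ i → i + p < b → T i = T (i + p)) ∧
      (x = 0 ∨ T (x - 1) ≠ T (x - 1 + p)) := by
  classical
  have hex : ∃ x, ∀ i, x ≤ i → i + p < b → T i = T (i + p) := ⟨a, h⟩
  refine ⟨Nat.find hex, Nat.find_min' hex h, Nat.find_spec hex, ?_⟩
  by_contra! hc
  refine Nat.find_min hex (m := Nat.find hex - 1) (by omega) fun i hi hib => ?_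
  rcases hi.eq_or_lt with rfl | hlt
  · exact hc.2
  · exact Nat.find_spec hex i (by omega) hib

/-- A `p`-periodic stretch starting at `a` can be extended maximally to the right
inside a string of length `n`. -/
theorem exists_right_maximal {α : Type*} (n : ℕ) (T : ℕ → α) (p a b : ℕ) (hb : 0 < b)
    (hbn : b ≤ n) (h : ∀ i, a ≤ i → i + p < b → T i = T (i + p)) :
    ∃ y, b ≤ y + 1 ∧ y < n ∧ (∀ i, a ≤ i → i + p ≤ y → T i = T (i + p)) ∧
      (y = n - 1 ∨ T (y + 1) ≠ T (y + 1 - p)) := by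
  classical
  let P : ℕ → Prop := fun y => ∀ i, a ≤ i → i + p ≤ y → T i = T (i + p)
  have hP : P (b - 1) := fun i hi hib => h i hi (by omega)
  have hle : Nat.findGreatest P (n - 1) ≤ n - 1 := Nat.findGreatest_le _
  have hge : b - 1 ≤ Nat.findGreatest P (n - 1) := Nat.le_findGreatest (by omega) hP
  have hspec : P (Nat.findGreatest P (n - 1)) := Nat.findGreatest_spec (by omega) hP
  refine ⟨Nat.findGreatest P (n - 1), by omega, by omega, hspec, ?_⟩
  by_contra! hc
  refine Nat.findGreatest_is_greatest (P := P) (n := n - 1) (Nat.lt_succ_self _) (by omega)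
    fun i hi hiy => ?_
  rcases hiy.eq_or_lt with heq | hlt
  · rw [heq, Nat.succ_eq_add_one, hc.2, ← Nat.succ_eq_add_one, ← heq, Nat.add_sub_cancel]
  · exact hspec i hi (by omega)

/-- every periodic fragment `T[a..b)` (with `p = per(T[a..b))`, `2p ≤ b-a`)
extends to exactly one run `T[x..y]` of `T` with the same smallest period,
where `x ≤ a` and `b - 1 ≤ y`. -/
theorem stmt7 {α : Type*} (n : ℕ) (T : ℕ → α) (a b : ℕ)
    (hab : a < b) (hbn : b ≤ n)
    (hp : 2 * perOf T a (b - a) ≤ b - a) :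
    ∃! xy : ℕ × ℕ, IsRun n T xy.1 xy.2 ∧
      perOf T xy.1 (xy.2 - xy.1 + 1) = perOf T a (b - a) ∧
      xy.1 ≤ a ∧ b - 1 ≤ xy.2 := by
  have hper := (isPeriod_length T a (show 1 ≤ b - a by omega)).isPeriod_perOf
  have hstretch : ∀ i, a ≤ i → i + perOf T a (b - a) < b → T i = T (i + perOf T a (b - a)) :=
    fun i hi hib => hper.eq_add hi (by omega)
  have hpos := hper.1
  obtain ⟨x, hxa, hx, hxmax⟩ := exists_left_maximal T _ a b hstretch
  obtain ⟨y, hby, hyn, hy, hymax⟩ := exists_right_maximal n T _ a b (by omega) hbn hstretch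
  have hxy : IsPeriod T x (y - x + 1) (perOf T a (b - a)) := by
    refine ⟨hpos, by omega, fun i hi => ?_⟩
    by_cases hia : a ≤ x + i
    · exact hy _ hia (by omega)
    · exact hx _ (by omega) (by omega)
  have hpereq : perOf T x (y - x + 1) = perOf T a (b - a) :=
    hxy.perOf_eq_of_subfragment (by omega) hxa (by omega)
  refine ⟨(x, y), ⟨⟨by omega, hyn, by simp only [hpereq]; omega, ?_, ?_⟩, hpereq, hxa, by omega⟩,
    ?_⟩
  · simpa only [hpereq] using hxmax
  · simpa only [hpereq] using hymax
  rintro ⟨u, v⟩ ⟨⟨huv, hvn, -, hu, hv⟩, hpuv, hua, hbv⟩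
  dsimp only at huv hvn hu hv hpuv hua hbv
  have hq := (isPeriod_length T u (show 1 ≤ v - u + 1 by omega)).isPeriod_perOf
  rw [hpuv] at hu hv hq
  generalize perOf T a (b - a) = p at *
  have hxu : x = u := by
    rcases lt_trichotomy x u with hlt | heq | hlt
    · exact absurd (hx (u - 1) (by omega) (by omega)) (hu.resolve_left (by omega))
    · exact heq
    · exact absurd (hq.eq_add (i := x - 1) (by omega) (by omega))
        (hxmax.resolve_left (by omega))
  have hyv : y = v := by
    rcases lt_trichotomy y v with hlt | heq | hlt
    · have := hq.eq_add (i := y + 1 - p) (by omega) (by omega)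
      rw [Nat.sub_add_cancel (by omega)] at this
      exact absurd this.symm (hymax.resolve_left (by omega))
    · exact heq
    · have := hy (v + 1 - p) (by omega) (by omega)
      rw [Nat.sub_add_cancel (by omega)] at this
      exact absurd this.symm (hv.resolve_left (by omega))
  rw [hxu, hyv]
end

section
/- Let S be a string of length n and let 0 ≤ i < j ≤ n with p := j − i. Define the string W of length n by W[a] = S[b], where b is the unique position with b ∈ [i..j) and p dividing (b − a). Then: (1) p is a period of W; (2) W[i..j) = S[i..j); and (3) the set of positions a ∈ [0..n) with S[a] ≠ W[a] is exactly Misper(S,i,j). Consequently, δ_H(S,W) = |Misper(S,i,j)|. -/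
theorem projPos_add_period (i p a : ℕ) : projPos i p (a + p) = projPos i p a := by
  simp [projPos]

theorem projPos_eq_self {i p a : ℕ} (hia : i ≤ a) (hap : a < i + p) :
    projPos i p a = a := by
  obtain ⟨d, rfl⟩ := Nat.exists_eq_add_of_le hia
  have hd : d < p := by omega
  have hr : i % p < p := Nat.mod_lt _ (by omega)
  have hmod : (i + d) % p = if p ≤ i % p + d then i % p + d - p else i % p + d := by
    rw [Nat.add_mod_eq_ite, Nat.mod_eq_of_lt hd]
  unfold projPos
  rw [hmod]
  split_ifs with h
  · rw [show i % p + d - p + p - i % p = d by omega, Nat.mod_eq_of_lt hd]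
  · rw [show i % p + d + p - i % p = d + p by omega, Nat.add_mod_right, Nat.mod_eq_of_lt hd]

theorem topK_eq_self {k : ℕ} {M : Finset ℕ} (h : M.card ≤ k) : topK k M = M :=
  Finset.filter_true_of_mem fun _ _ => (Finset.card_filter_le _ _).trans h

theorem botK_eq_self {k : ℕ} {M : Finset ℕ} (h : M.card ≤ k) : botK k M = M :=
  Finset.filter_true_of_mem fun _ _ => (Finset.card_filter_le _ _).trans h

theorem card_misperiods_le {α : Type*} [DecidableEq α] (n : ℕ) (S : ℕ → α) (i j : ℕ) :
    (misperiods n S i j).card ≤ n :=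
  (Finset.card_filter_le _ _).trans (Finset.card_range n).le

theorem misperAll_eq_misperiods {α : Type*} [DecidableEq α] {n i j : ℕ} (S : ℕ → α)
    (hij : i ≤ j) : misperAll n S i j = misperiods n S i j := by
  have hcard := card_misperiods_le n S i j
  rw [misperAll, misperK, topK_eq_self ((Finset.card_filter_le _ _).trans hcard),
    botK_eq_self ((Finset.card_filter_le _ _).trans hcard), ← Finset.filter_or]
  refine Finset.filter_true_of_mem fun a ha => ?_
  by_contra! h
  refine (Finset.mem_filter.mp ha).2 ?_
  rw [projPos_eq_self h.1 (by omega)]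

/-- let `W` be the `p`-periodic extension of `S[i..j)` (with `p = j - i`)
to length `n`, i.e. `W a = S b` for the unique `b ∈ [i..j)` with `p ∣ (b - a)`. Then
(1) `p` is a period of `W`; (2) `W` agrees with `S` on `[i..j)`; (3) the positions where
`S` and `W` differ are exactly `Misper(S,i,j)`; hence `δ_H(S,W) = |Misper(S,i,j)|`. -/
theorem stmt14 {α : Type*} [DecidableEq α] (n i j : ℕ) (S : ℕ → α)
    (hij : i < j) (hjn : j ≤ n) :
    IsPeriod (fun a => S (projPos i (j - i) a)) 0 n (j - i) ∧
    (∀ a, i ≤ a → a < j → S (projPos i (j - i) a) = S a) ∧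
    ((Finset.range n).filter fun a => S a ≠ S (projPos i (j - i) a)) = misperAll n S i j ∧
    hammingN n S (fun a => S (projPos i (j - i) a)) = (misperAll n S i j).card := by
  have hall := misperAll_eq_misperiods (n := n) S hij.le
  refine ⟨⟨by omega, by omega, fun a _ => ?_⟩, fun a hia haj => ?_, ?_, ?_⟩
  · simp only [projPos_add_period]
  · rw [projPos_eq_self hia (by omega)]
  · rw [hall, misperiods]
  · rw [hall, hammingN, misperiods]
end

section
/- There exists a constant C > 0 such that the following holds. Let T be a string of length n, k ≥ 1 an integer, and γ an integer with 2 ≤ γ ≤ ⌊n/(k+1)⌋, and set τ = ⌊γ/3⌋, assuming 1 ≤ τ ≤ n/2. Then: (i) there exists a τ-synchronizing set A1 of T with |A1| ≤ C·n/γ; and (ii) the set A2, defined as the union over all τ-runs T[x..y] of T (with p = per(T[x..y])) of Misper_{k+1}(T,x,x+p), satisfies |A2| ≤ C·n·k/γ. -/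
namespace IsPeriod

variable {α : Type*} {S : ℕ → α} {x x' len len' p p' : ℕ}

theorem mono (h : IsPeriod S x len p) (hx : x ≤ x') (hy : x' + len' ≤ x + len) (hp : p ≤ len') :
    IsPeriod S x' len' p := by
  refine ⟨h.1, hp, fun a ha => ?_⟩
  have := h.2.2 (x' - x + a) (by omega)
  rwa [show x + (x' - x + a) = x' + a by omega] at this

theorem eq_of_le (h : IsPeriod S x len p) {a : ℕ} (hx : x ≤ a) (ha : a + p < x + len) :
    S a = S (a + p) := by
  have := h.2.2 (a - x) (by omega)
  rwa [show x + (a - x) = a by omega] at this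

theorem congr (h : IsPeriod S x len p) (hS : ∀ d < len, S (x + d) = S (x' + d)) :
    IsPeriod S x' len p := by
  refine ⟨h.1, h.2.1, fun a ha => ?_⟩
  rw [← hS a (by omega), add_assoc, ← hS (a + p) ha, ← add_assoc]
  exact h.2.2 a ha

theorem extend_left (h : IsPeriod S (x + 1) len p) (hS : S x = S (x + p)) :
    IsPeriod S x (len + 1) p := by
  refine ⟨h.1, by have := h.2.1; omega, fun a ha => ?_⟩
  rcases Nat.eq_zero_or_pos a with rfl | ha'
  · simpa using hS
  · exact h.eq_of_le (by omega) (by omega)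

theorem extend_right (h : IsPeriod S x len p) (hS : S (x + len - p) = S (x + len)) :
    IsPeriod S x (len + 1) p := by
  have hp := h.2.1
  refine ⟨h.1, by omega, fun a ha => ?_⟩
  rcases Nat.lt_or_ge (a + p) len with ha' | ha'
  · exact h.2.2 a ha'
  · rwa [show x + a + p = x + len by omega, show x + a = x + len - p by omega]

/-- If two periodic fragments overlap enough, the period of the one starting later
continues one position to the left. -/
theorem overlap_left (h : IsPeriod S x len p) (h' : IsPeriod S (x' + 1) len' p') (hx : x ≤ x')
    (hy : x' + p + p' < x + len) (hy' : p + p' ≤ len') : S x' = S (x' + p') := by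
  have hp := h.1
  rw [h.eq_of_le hx (by omega), h'.eq_of_le (a := x' + p) (by omega) (by omega),
    h.eq_of_le (a := x' + p') (by omega) (by omega), add_right_comm]

/-- If two periodic fragments overlap enough, the period of the one ending earlier
continues one position to the right. -/
theorem overlap_right (h : IsPeriod S x len p) (h' : IsPeriod S x' len' p')
    (hx : p + p' ≤ len) (hx' : x' + p + p' ≤ x + len) (hy : x + len < x' + len') :
    S (x + len - p) = S (x + len) := by
  have hp := h.1
  have hp' := h'.1
  have h1 := h'.eq_of_le (a := x + len - p') (by omega) (by omega)
  have h2 := h.eq_of_le (a := x + len - p' - p) (by omega) (by omega)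
  have h3 := h'.eq_of_le (a := x + len - p' - p) (by omega) (by omega)
  rw [show x + len - p' + p' = x + len by omega] at h1
  rw [show x + len - p' - p + p = x + len - p' by omega] at h2
  rw [show x + len - p' - p + p' = x + len - p by omega] at h3
  rw [← h3, h2, h1]

end IsPeriod

theorem perOf_isPeriod {α : Type*} (S : ℕ → α) (x : ℕ) {len : ℕ} (h : 1 ≤ len) :
    IsPeriod S x len (perOf S x len) :=
  Nat.sInf_mem (s := {p | IsPeriod S x len p}) ⟨len, h, le_rfl, fun a ha => by omega⟩

/-- The length-`len` fragment of `S` starting at `x` has a period at most `τ / 3`. -/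
def HasSmallPeriod {α : Type*} (S : ℕ → α) (τ x len : ℕ) : Prop :=
  ∃ p, IsPeriod S x len p ∧ 3 * p ≤ τ

theorem three_mul_perOf_le_iff {α : Type*} {S : ℕ → α} {τ x len : ℕ} (h : 1 ≤ len) :
    3 * perOf S x len ≤ τ ↔ HasSmallPeriod S τ x len := by
  constructor
  · exact fun h' => ⟨_, perOf_isPeriod S x h, h'⟩
  · rintro ⟨p, hp, hpτ⟩
    have : perOf S x len ≤ p := Nat.sInf_le hp
    omega

theorem HasSmallPeriod.congr {α : Type*} {S : ℕ → α} {τ x x' len : ℕ}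
    (h : HasSmallPeriod S τ x len) (hS : ∀ d < len, S (x + d) = S (x' + d)) :
    HasSmallPeriod S τ x' len := by
  obtain ⟨p, hp, hpτ⟩ := h
  exact ⟨p, hp.congr hS, hpτ⟩

/-- Gluing consecutive windows of length `τ` that all have a small period. -/
theorem HasSmallPeriod.glue {α : Type*} {S : ℕ → α} {τ x : ℕ} (t : ℕ)
    (h : ∀ e ≤ t, HasSmallPeriod S τ (x + e) τ) : HasSmallPeriod S τ x (τ + t) := by
  induction t with
  | zero => exact h 0 le_rfl
  | succ t ih =>
    obtain ⟨p, hp, hpτ⟩ := ih fun e he => h e (by omega)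
    obtain ⟨q, hq, hqτ⟩ := h (t + 1) le_rfl
    have hp1 := hp.1
    have hq1 := hq.1
    exact ⟨p, hp.extend_right
      (hp.overlap_right hq (by omega) (by omega) (by omega)), hpτ⟩

/-- The window of length `τ` at `j` has no small period, but removing its first or its last
letter leaves a fragment with a small period. -/
def IsBoundary {α : Type*} (S : ℕ → α) (τ j : ℕ) : Prop :=
  ¬ HasSmallPeriod S τ j τ ∧
    (HasSmallPeriod S τ j (τ - 1) ∨ HasSmallPeriod S τ (j + 1) (τ - 1))

theorem IsBoundary.congr {α : Type*} {S : ℕ → α} {τ j j' : ℕ} (h : IsBoundary S τ j)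
    (hS : ∀ d < τ, S (j + d) = S (j' + d)) : IsBoundary S τ j' := by
  refine ⟨fun h' => h.1 (h'.congr fun d hd => (hS d hd).symm), h.2.imp ?_ ?_⟩
  · exact fun h' => h'.congr fun d hd => hS d (by omega)
  · refine fun h' => h'.congr fun d hd => ?_
    have := hS (d + 1) (by omega)
    rwa [← add_assoc, ← add_assoc, add_right_comm j, add_right_comm j'] at this

theorem not_hasSmallPeriod_succ {α : Type*} {S : ℕ → α} {τ j : ℕ}
    (h : ¬ HasSmallPeriod S τ j τ) (hB : ¬ IsBoundary S τ j) :
    ¬ HasSmallPeriod S τ (j + 1) τ := by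
  rintro ⟨p, hp, hpτ⟩
  have := hp.1
  exact hB ⟨h, .inr ⟨p, hp.mono le_rfl (by omega) (by omega), hpτ⟩⟩

theorem not_hasSmallPeriod_of_succ {α : Type*} {S : ℕ → α} {τ j : ℕ}
    (h : ¬ HasSmallPeriod S τ (j + 1) τ) (hB : ¬ IsBoundary S τ (j + 1)) :
    ¬ HasSmallPeriod S τ j τ := by
  rintro ⟨p, hp, hpτ⟩
  have := hp.1
  exact hB ⟨h, .inl ⟨p, hp.mono (by omega) (by omega) (by omega), hpτ⟩⟩

/-- Without boundary positions, one window without a small period forces all of them to be so. -/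
theorem not_hasSmallPeriod_of_no_boundary {α : Type*} {S : ℕ → α} {τ i m e₀ : ℕ}
    (hB : ∀ e < m, ¬ IsBoundary S τ (i + e)) (he₀ : e₀ < m)
    (h : ¬ HasSmallPeriod S τ (i + e₀) τ) : ∀ e < m, ¬ HasSmallPeriod S τ (i + e) τ := by
  intro e he
  rcases le_total e₀ e with hle | hle
  · induction e, hle using Nat.le_induction with
    | base => exact h
    | succ e hle ih => exact not_hasSmallPeriod_succ (ih (by omega)) (hB e (by omega))
  · induction hle using Nat.decreasingInduction with
    | self => exact h
    | of_succ e hle ih =>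
      exact not_hasSmallPeriod_of_succ (ih (by omega)) (hB (e + 1) (by omega))

/-- A set of naturals below `n` whose elements are pairwise at distance at least `g`
has at most `n / g + 1` elements. -/
theorem card_le_of_gaps {n g : ℕ} (hg : 1 ≤ g) (B : Finset ℕ) (hn : ∀ b ∈ B, b < n)
    (hB : ∀ b ∈ B, ∀ c ∈ B, b < c → b + g ≤ c) : B.card ≤ n / g + 1 := by
  have key : ∀ b ∈ B, ∀ c ∈ B, b < c → b / g < c / g := fun b hb c hc hbc => by
    have := Nat.div_le_div_right (c := g) (hB b hb c hc hbc)
    rw [Nat.add_div_right _ hg] at this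
    omega
  rw [← Finset.card_range (n / g + 1)]
  refine Finset.card_le_card_of_injOn (· / g) (fun b hb => ?_) (fun b hb c hc hbc => ?_)
  · have := Nat.div_le_div_right (c := g) (hn b hb).le
    simp only [Finset.coe_range, Set.mem_Iio]
    omega
  · simp only at hbc
    rcases lt_trichotomy b c with h | h | h
    · have := key b hb c hc h
      omega
    · exact h
    · have := key c hc b hb h
      omega

open Classical in
theorem card_boundary_le {α : Type*} (S : ℕ → α) {τ : ℕ} (hτ : 1 ≤ τ) (n : ℕ) :
    ((Finset.range n).filter (IsBoundary S τ)).card ≤ 2 * (n / ((τ + 2) / 3) + 1) := by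
  have hR : ((Finset.range n).filter fun j =>
      ¬ HasSmallPeriod S τ j τ ∧ HasSmallPeriod S τ j (τ - 1)).card ≤
        n / ((τ + 2) / 3) + 1 := by
    refine card_le_of_gaps (by omega) _ (fun b hb => by simp at hb; exact hb.1) ?_
    intro b hb c hc hbc
    simp only [Finset.mem_filter] at hb hc
    obtain ⟨-, hb, p, hp, hpτ⟩ := hb
    obtain ⟨-, -, q, hq, hqτ⟩ := hc
    by_contra hlt
    have hp1 := hp.1
    have := hp.extend_right (hp.overlap_right hq (by omega) (by omega) (by omega))
    rw [show τ - 1 + 1 = τ by omega] at this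
    exact hb ⟨p, this, hpτ⟩
  have hL : ((Finset.range n).filter fun j =>
      ¬ HasSmallPeriod S τ j τ ∧ HasSmallPeriod S τ (j + 1) (τ - 1)).card ≤
        n / ((τ + 2) / 3) + 1 := by
    refine card_le_of_gaps (by omega) _ (fun b hb => by simp at hb; exact hb.1) ?_
    intro b hb c hc hbc
    simp only [Finset.mem_filter] at hb hc
    obtain ⟨-, -, p, hp, hpτ⟩ := hb
    obtain ⟨-, hc, q, hq, hqτ⟩ := hc
    by_contra hlt
    have hp1 := hp.1
    have := hq.extend_left (hp.overlap_left hq (by omega) (by omega) (by omega))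
    rw [show τ - 1 + 1 = τ by omega] at this
    exact hc ⟨q, this, hqτ⟩
  calc _ ≤ (((Finset.range n).filter fun j =>
          ¬ HasSmallPeriod S τ j τ ∧ HasSmallPeriod S τ j (τ - 1)) ∪
        ((Finset.range n).filter fun j =>
          ¬ HasSmallPeriod S τ j τ ∧ HasSmallPeriod S τ (j + 1) (τ - 1))).card := by
        refine Finset.card_le_card fun j hj => ?_
        simp only [Finset.mem_filter, IsBoundary, Finset.mem_union] at hj ⊢
        tauto
    _ ≤ _ := by
        refine (Finset.card_union_le _ _).trans ?_
        omega

/-- A uniformly random permutation is smallest on `S` at a fixed `w ∈ S` with probability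
at most `1 / |S|`. -/
theorem card_mul_card_perm_min_le {N : ℕ} (S : Finset (Fin N)) {w : Fin N} (hw : w ∈ S) :
    S.card * (Finset.univ.filter fun σ : Equiv.Perm (Fin N) => ∀ v ∈ S, σ w ≤ σ v).card ≤
      Fintype.card (Equiv.Perm (Fin N)) := by
  let M : Fin N → Finset (Equiv.Perm (Fin N)) := fun u =>
    Finset.univ.filter fun σ => ∀ v ∈ S, σ u ≤ σ v
  have hM : ∀ u ∈ S, (M w).card ≤ (M u).card := fun u hu => by
    refine Finset.card_le_card_of_injOn (· * Equiv.swap w u) (fun σ hσ => ?_)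
      (fun σ _ σ' _ h => mul_right_cancel h)
    simp only [M, Finset.coe_filter, Finset.mem_univ, true_and, Set.mem_ofPred_eq,
      Equiv.Perm.mul_apply, Equiv.swap_apply_right] at hσ ⊢
    intro v hv
    apply hσ
    rw [Equiv.swap_apply_def]
    split_ifs <;> assumption
  have hdisj : (S : Set (Fin N)).PairwiseDisjoint M := fun u hu v hv huv => by
    refine Finset.disjoint_left.2 fun σ hσ hσ' => huv (σ.injective ?_)
    simp only [M, Finset.mem_filter, Finset.mem_univ, true_and] at hσ hσ'
    exact le_antisymm (hσ v hv) (hσ' u hu)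
  calc S.card * (M w).card = ∑ _u ∈ S, (M w).card := by simp
    _ ≤ ∑ u ∈ S, (M u).card := Finset.sum_le_sum hM
    _ = (S.biUnion M).card := (Finset.card_biUnion hdisj).symm
    _ ≤ _ := Finset.card_le_univ _

theorem mul_sum_card_perm_min_le {N m : ℕ} (I : Finset ℕ) (S : ℕ → Finset (Fin N))
    (w : ℕ → Fin N) (hw : ∀ i ∈ I, w i ∈ S i) (hm : ∀ i ∈ I, m ≤ (S i).card) :
    m * ∑ σ : Equiv.Perm (Fin N), (I.filter fun i => ∀ v ∈ S i, σ (w i) ≤ σ v).card ≤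
      I.card * Fintype.card (Equiv.Perm (Fin N)) := by
  have hswap : ∑ σ : Equiv.Perm (Fin N), (I.filter fun i => ∀ v ∈ S i, σ (w i) ≤ σ v).card =
      ∑ i ∈ I, (Finset.univ.filter fun σ : Equiv.Perm (Fin N) =>
        ∀ v ∈ S i, σ (w i) ≤ σ v).card := by
    simp only [Finset.card_filter]
    exact Finset.sum_comm
  rw [hswap, Finset.mul_sum, ← smul_eq_mul I.card]
  refine Finset.sum_le_card_nsmul _ _ _ fun i hi => ?_
  exact (Nat.mul_le_mul_right _ (hm i hi)).trans (card_mul_card_perm_min_le _ (hw i hi))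

theorem exists_perm_min_le {N m : ℕ} (I : Finset ℕ) (S S' : ℕ → Finset (Fin N))
    (w w' : ℕ → Fin N) (hw : ∀ i ∈ I, w i ∈ S i) (hm : ∀ i ∈ I, m ≤ (S i).card)
    (hw' : ∀ i ∈ I, w' i ∈ S' i) (hm' : ∀ i ∈ I, m ≤ (S' i).card) :
    ∃ σ : Equiv.Perm (Fin N), m * ((I.filter fun i => ∀ v ∈ S i, σ (w i) ≤ σ v).card +
      (I.filter fun i => ∀ v ∈ S' i, σ (w' i) ≤ σ v).card) ≤ 2 * I.card := by
  have h := mul_sum_card_perm_min_le I S w hw hm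
  have h' := mul_sum_card_perm_min_le I S' w' hw' hm'
  have hex := Finset.exists_le_of_sum_le
    (s := (Finset.univ : Finset (Equiv.Perm (Fin N))))
    (f := fun σ => m * ((I.filter fun i => ∀ v ∈ S i, σ (w i) ≤ σ v).card +
      (I.filter fun i => ∀ v ∈ S' i, σ (w' i) ≤ σ v).card))
    (g := fun _ => 2 * I.card) Finset.univ_nonempty (by
      rw [← Finset.mul_sum, Finset.sum_add_distrib, Finset.sum_const, Finset.card_univ,
        smul_eq_mul]
      linarith)
  obtain ⟨σ, -, hσ⟩ := hex
  exact ⟨σ, hσ⟩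

open Classical in
/-- The first position of `S` at which the length-`τ` window at `j` occurs. -/
noncomputable def firstOcc {α : Type*} (S : ℕ → α) (τ j : ℕ) : ℕ :=
  Nat.find (p := fun i => ∀ d < τ, S (i + d) = S (j + d)) ⟨j, fun _ _ => rfl⟩

theorem firstOcc_spec {α : Type*} (S : ℕ → α) (τ j : ℕ) :
    ∀ d < τ, S (firstOcc S τ j + d) = S (j + d) := by
  classical
  exact Nat.find_spec (p := fun i => ∀ d < τ, S (i + d) = S (j + d)) ⟨j, fun _ _ => rfl⟩

theorem firstOcc_le {α : Type*} (S : ℕ → α) (τ j : ℕ) : firstOcc S τ j ≤ j := by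
  classical
  exact Nat.find_min' _ fun _ _ => rfl

theorem firstOcc_congr {α : Type*} {S : ℕ → α} {τ j j' : ℕ}
    (h : ∀ d < τ, S (j + d) = S (j' + d)) : firstOcc S τ j = firstOcc S τ j' := by
  classical
  unfold firstOcc
  congr 1
  ext i
  exact forall₂_congr fun d hd => by rw [h d hd]

theorem firstOcc_ne {α : Type*} {S : ℕ → α} {τ j j' : ℕ} (hj : ¬ HasSmallPeriod S τ j τ)
    (hlt : j < j') (hle : 3 * (j' - j) ≤ τ) : firstOcc S τ j ≠ firstOcc S τ j' := by
  intro h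
  refine hj ⟨j' - j, ⟨by omega, by omega, fun a ha => ?_⟩, hle⟩
  rw [← firstOcc_spec S τ j a (by omega), h, firstOcc_spec S τ j' a (by omega)]
  congr 1
  omega

/-- `firstOcc` truncated to `Fin (n + 1)`. -/
noncomputable def windowId {α : Type*} (S : ℕ → α) (n τ j : ℕ) : Fin (n + 1) :=
  ⟨min (firstOcc S τ j) n, by omega⟩

theorem windowId_congr {α : Type*} {S : ℕ → α} {n τ j j' : ℕ}
    (h : ∀ d < τ, S (j + d) = S (j' + d)) : windowId S n τ j = windowId S n τ j' := by
  simp [windowId, firstOcc_congr h]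

theorem card_image_windowId {α : Type*} {S : ℕ → α} {n τ i m : ℕ} (hm : 3 * m ≤ τ)
    (hn : i + m ≤ n) (hQ : ∀ e ≤ m, ¬ HasSmallPeriod S τ (i + e) τ) :
    ((Finset.range (m + 1)).image fun e => windowId S n τ (i + e)).card = m + 1 := by
  have key : ∀ e e', e < e' → e' ≤ m → windowId S n τ (i + e) ≠ windowId S n τ (i + e') := by
    intro e e' hlt hle h
    have h1 := firstOcc_le S τ (i + e)
    have h2 := firstOcc_le S τ (i + e')
    simp only [windowId, Fin.mk.injEq] at h
    exact firstOcc_ne (hQ e (by omega)) (by omega : i + e < i + e') (by omega) (by omega)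
  rw [Finset.card_image_of_injOn, Finset.card_range]
  intro e he e' he' h
  simp only [Finset.coe_range, Set.mem_Iio] at he he'
  rcases lt_trichotomy e e' with hlt | heq | hlt
  · exact absurd h (key e e' hlt (by omega))
  · exact heq
  · exact absurd h.symm (key e' e hlt (by omega))

/-- Membership in the synchronizing set determined by a permutation of window identifiers:
a boundary window at either end, or a window minimal among the windows in between, none of
which has a small period. -/
def IsSyncPos {α : Type*} (S : ℕ → α) (n τ : ℕ) (σ : Equiv.Perm (Fin (n + 1))) (i : ℕ) : Prop :=
  IsBoundary S τ i ∨ IsBoundary S τ (i + τ) ∨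
    ((∀ e ≤ τ, ¬ HasSmallPeriod S τ (i + e) τ) ∧
      ((∀ e ≤ τ, σ (windowId S n τ i) ≤ σ (windowId S n τ (i + e))) ∨
        (∀ e ≤ τ, σ (windowId S n τ (i + τ)) ≤ σ (windowId S n τ (i + e)))))

theorem IsSyncPos.congr {α : Type*} {S : ℕ → α} {n τ : ℕ} {σ : Equiv.Perm (Fin (n + 1))}
    {i j : ℕ} (h : IsSyncPos S n τ σ i) (hS : ∀ d < 2 * τ, S (i + d) = S (j + d)) :
    IsSyncPos S n τ σ j := by
  have hwin : ∀ e ≤ τ, ∀ d < τ, S (i + e + d) = S (j + e + d) := fun e he d hd => by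
    rw [add_assoc, add_assoc]
    exact hS _ (by omega)
  have hwin0 : ∀ d < τ, S (i + d) = S (j + d) := hwin 0 (by omega)
  have hid : ∀ e ≤ τ, windowId S n τ (j + e) = windowId S n τ (i + e) := fun e he =>
    (windowId_congr (hwin e he)).symm
  have hid0 : windowId S n τ j = windowId S n τ i := hid 0 (by omega)
  refine h.imp (fun h => h.congr hwin0) (Or.imp (fun h => h.congr (hwin τ le_rfl)) ?_)
  rintro ⟨hQ, hmin⟩
  refine ⟨fun e he h => hQ e he (h.congr fun d hd => (hwin e he d hd).symm), ?_⟩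
  rw [hid0, hid τ le_rfl]
  refine hmin.imp ?_ ?_ <;> exact fun h e he => by rw [hid e he]; exact h e he

theorem not_isSyncPos_of_hasSmallPeriod {α : Type*} {S : ℕ → α} {n τ : ℕ}
    {σ : Equiv.Perm (Fin (n + 1))} {i : ℕ} (h : HasSmallPeriod S τ i (3 * τ - 1)) :
    ∀ d < τ, ¬ IsSyncPos S n τ σ (i + d) := by
  intro d hd
  obtain ⟨p, hp, hpτ⟩ := h
  have hQ : ∀ e ≤ τ, HasSmallPeriod S τ (i + d + e) τ := fun e he =>
    ⟨p, hp.mono (by omega) (by omega) (by omega), hpτ⟩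
  rintro (h | h | h)
  · exact h.1 (hQ 0 (by omega))
  · exact h.1 (hQ τ le_rfl)
  · exact h.1 0 (by omega) (hQ 0 (by omega))

theorem hasSmallPeriod_of_not_isSyncPos {α : Type*} {S : ℕ → α} {n τ : ℕ}
    {σ : Equiv.Perm (Fin (n + 1))} {i : ℕ} (hτ : 1 ≤ τ)
    (h : ∀ d < τ, ¬ IsSyncPos S n τ σ (i + d)) : HasSmallPeriod S τ i (3 * τ - 1) := by
  have hB : ∀ e < 2 * τ, ¬ IsBoundary S τ (i + e) := fun e he hb => by
    rcases Nat.lt_or_ge e τ with hlt | hge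
    · exact h e hlt (.inl hb)
    · refine h (e - τ) (by omega) (.inr (.inl ?_))
      rwa [show i + (e - τ) + τ = i + e by omega]
  have hQ : ∀ e < 2 * τ, HasSmallPeriod S τ (i + e) τ := by
    by_contra! hne
    obtain ⟨e₀, he₀, hne⟩ := hne
    have hall := not_hasSmallPeriod_of_no_boundary hB he₀ hne
    obtain ⟨e, he, hmin⟩ := Finset.exists_min_image (Finset.range (2 * τ))
      (fun e => σ (windowId S n τ (i + e))) ⟨0, by simp; omega⟩
    simp only [Finset.mem_range] at he hmin
    have hsub : ∀ d < τ, ∀ f ≤ τ, ¬ HasSmallPeriod S τ (i + d + f) τ := fun d hd f hf => by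
      rw [add_assoc]
      exact hall _ (by omega)
    rcases Nat.lt_or_ge e τ with hlt | hge
    · refine h e hlt (.inr (.inr ⟨hsub e hlt, .inl fun f hf => ?_⟩))
      rw [add_assoc]
      exact hmin _ (by omega)
    · refine h (e - τ) (by omega) (.inr (.inr ⟨hsub (e - τ) (by omega), .inr fun f hf => ?_⟩))
      rw [show i + (e - τ) + τ = i + e by omega, add_assoc]
      exact hmin _ (by omega)
  have := HasSmallPeriod.glue (2 * τ - 1) fun e he => hQ e (by omega)
  rwa [show τ + (2 * τ - 1) = 3 * τ - 1 by omega] at this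

open Classical in
theorem isSyncSet_filter_isSyncPos {α : Type*} (S : ℕ → α) {n τ : ℕ}
    (σ : Equiv.Perm (Fin (n + 1))) (hτ : 1 ≤ τ) :
    IsSyncSet n τ S ((Finset.range (n + 1)).filter fun i =>
      i + 2 * τ ≤ n ∧ IsSyncPos S n τ σ i) := by
  refine ⟨fun a ha => (Finset.mem_filter.1 ha).2.1, fun i j hi hj hS => ?_, fun i hi => ?_⟩
  · simp only [Finset.mem_filter, Finset.mem_range]
    constructor
    · exact fun h => ⟨by omega, hj, h.2.2.congr hS⟩
    · exact fun h => ⟨by omega, hi, h.2.2.congr fun d hd => (hS d hd).symm⟩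
  · rw [three_mul_perOf_le_iff (by omega)]
    simp only [Finset.mem_filter, Finset.mem_range]
    constructor
    · exact fun h => hasSmallPeriod_of_not_isSyncPos hτ fun d hd hpos =>
        h d hd ⟨by omega, by omega, hpos⟩
    · exact fun h d hd hpos => not_isSyncPos_of_hasSmallPeriod h d hd hpos.2.2

open Classical in
theorem exists_isSyncSet {α : Type*} (S : ℕ → α) {n τ : ℕ} (hτ : 1 ≤ τ) (hn : 2 * τ ≤ n) :
    ∃ A : Finset ℕ, IsSyncSet n τ S A ∧ τ * A.card ≤ 30 * n := by
  set m := τ / 3 with hm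
  set I := (Finset.range (n + 1)).filter fun i =>
    i + 2 * τ ≤ n ∧ ∀ e ≤ τ, ¬ HasSmallPeriod S τ (i + e) τ with hI
  obtain ⟨σ, hσ⟩ := exists_perm_min_le (m := m + 1) I
    (fun i => (Finset.range (m + 1)).image fun e => windowId S n τ (i + e))
    (fun i => (Finset.range (m + 1)).image fun e => windowId S n τ (i + (τ - m) + e))
    (fun i => windowId S n τ i) (fun i => windowId S n τ (i + τ))
    (fun i _ => Finset.mem_image.2 ⟨0, by simp, rfl⟩)
    (fun i hi => by
      simp only [hI, Finset.mem_filter] at hi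
      exact (card_image_windowId (by omega) (by omega) fun e he => hi.2.2 e (by omega)).ge)
    (fun i _ => Finset.mem_image.2 ⟨m, by simp, by
      rw [show i + (τ - m) + m = i + τ by omega]⟩)
    (fun i hi => by
      simp only [hI, Finset.mem_filter] at hi
      refine (card_image_windowId (by omega) (by omega) fun e he => ?_).ge
      rw [add_assoc]
      exact hi.2.2 _ (by omega))
  refine ⟨_, isSyncSet_filter_isSyncPos S σ hτ, ?_⟩
  set B := (Finset.range (n + 1)).filter (IsBoundary S τ) with hBdef
  have hB := card_boundary_le S hτ (n + 1)
  set L := I.filter fun i => ∀ v ∈ (Finset.range (m + 1)).image fun e => windowId S n τ (i + e),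
    σ (windowId S n τ i) ≤ σ v with hL
  set R := I.filter fun i => ∀ v ∈ (Finset.range (m + 1)).image fun e =>
    windowId S n τ (i + (τ - m) + e), σ (windowId S n τ (i + τ)) ≤ σ v with hR
  have hsub : ((Finset.range (n + 1)).filter fun i => i + 2 * τ ≤ n ∧ IsSyncPos S n τ σ i) ⊆
      (B ∪ B.image (· - τ)) ∪ (L ∪ R) := by
    intro i hi
    simp only [Finset.mem_filter, Finset.mem_range] at hi
    obtain ⟨hi, hin, h | h | ⟨hQ, hmin⟩⟩ := hi
    · exact Finset.mem_union_left _ (Finset.mem_union_left _ (by simp [hBdef, hi, h]))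
    · refine Finset.mem_union_left _ (Finset.mem_union_right _ (Finset.mem_image.2 ⟨i + τ, ?_, ?_⟩))
      · simp only [hBdef, Finset.mem_filter, Finset.mem_range]
        exact ⟨by omega, h⟩
      · simp
    · have hiI : i ∈ I := by
        simp only [hI, Finset.mem_filter, Finset.mem_range]
        exact ⟨hi, hin, hQ⟩
      refine Finset.mem_union_right _ (Finset.mem_union.2 (hmin.imp ?_ ?_))
      · intro h
        refine Finset.mem_filter.2 ⟨hiI, Finset.forall_mem_image.2 fun e he => h e ?_⟩
        have := Finset.mem_range.1 he
        omega
      · intro h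
        refine Finset.mem_filter.2 ⟨hiI, Finset.forall_mem_image.2 fun e he => ?_⟩
        have := Finset.mem_range.1 he
        rw [add_assoc]
        exact h _ (by omega)
  have hcard := (Finset.card_le_card hsub).trans
    ((Finset.card_union_le _ _).trans (add_le_add
      ((Finset.card_union_le _ _).trans (add_le_add le_rfl Finset.card_image_le))
      (Finset.card_union_le _ _)))
  have hIcard : I.card ≤ n := by
    have : I ⊆ Finset.range n := fun i hi => by
      simp only [hI, Finset.mem_filter] at hi
      exact Finset.mem_range.2 (by omega)
    simpa using Finset.card_le_card this
  have hg : (τ + 2) / 3 * ((n + 1) / ((τ + 2) / 3)) ≤ n + 1 := Nat.mul_div_le _ _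
  have hg' : (τ + 2) / 3 * B.card ≤ 2 * (n + 1 + (τ + 2) / 3) := by
    calc _ ≤ (τ + 2) / 3 * (2 * ((n + 1) / ((τ + 2) / 3) + 1)) := Nat.mul_le_mul_left _ hB
      _ = 2 * ((τ + 2) / 3 * ((n + 1) / ((τ + 2) / 3)) + (τ + 2) / 3) := by ring
      _ ≤ _ := by omega
  have hτB : τ * B.card ≤ 12 * n := by
    calc τ * B.card ≤ 3 * ((τ + 2) / 3) * B.card := Nat.mul_le_mul_right _ (by omega)
      _ = 3 * ((τ + 2) / 3 * B.card) := by ring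
      _ ≤ 3 * (2 * (n + 1 + (τ + 2) / 3)) := Nat.mul_le_mul_left _ hg'
      _ ≤ 12 * n := by omega
  have hτLR : τ * (L.card + R.card) ≤ 6 * n := by
    calc τ * (L.card + R.card) ≤ 3 * (m + 1) * (L.card + R.card) :=
          Nat.mul_le_mul_right _ (by omega)
      _ = 3 * ((m + 1) * (L.card + R.card)) := by ring
      _ ≤ 3 * (2 * I.card) := Nat.mul_le_mul_left _ hσ
      _ ≤ 6 * n := by omega
  calc _ ≤ τ * (B.card + B.card + (L.card + R.card)) := Nat.mul_le_mul_left _ hcard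
    _ = 2 * (τ * B.card) + τ * (L.card + R.card) := by ring
    _ ≤ 30 * n := by omega

theorem card_topK_le (k : ℕ) (M : Finset ℕ) : (topK k M).card ≤ k := by
  rcases (topK k M).eq_empty_or_nonempty with h | h
  · simp [h]
  · have hmin := (Finset.mem_filter.1 ((topK k M).min'_mem h)).2
    refine le_trans (Finset.card_le_card fun a ha => ?_) hmin
    exact Finset.mem_filter.2 ⟨(Finset.mem_filter.1 ha).1, Finset.min'_le _ _ ha⟩

theorem card_botK_le (k : ℕ) (M : Finset ℕ) : (botK k M).card ≤ k := by
  rcases (botK k M).eq_empty_or_nonempty with h | h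
  · simp [h]
  · have hmax := (Finset.mem_filter.1 ((botK k M).max'_mem h)).2
    refine le_trans (Finset.card_le_card fun a ha => ?_) hmax
    exact Finset.mem_filter.2 ⟨(Finset.mem_filter.1 ha).1, Finset.le_max' _ _ ha⟩

theorem card_misperK_le {α : Type*} [DecidableEq α] (k n : ℕ) (S : ℕ → α) (i j : ℕ) :
    (misperK k n S i j).card ≤ 2 * k := by
  have h1 := card_topK_le k ((misperiods n S i j).filter fun a => a < i)
  have h2 := card_botK_le k ((misperiods n S i j).filter fun a => j ≤ a)
  have := Finset.card_union_le (topK k ((misperiods n S i j).filter fun a => a < i))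
    (botK k ((misperiods n S i j).filter fun a => j ≤ a))
  unfold misperK
  omega

namespace IsTauRun

variable {α : Type*} {T : ℕ → α} {n τ x y x' y' : ℕ}

theorem isPeriod (_h : IsTauRun n T τ x y) :
    IsPeriod T x (y - x + 1) (perOf T x (y - x + 1)) :=
  perOf_isPeriod T x (by omega)

theorem not_lt_of_same_start (h : IsTauRun n T τ x y) (h' : IsTauRun n T τ x y') : ¬ y < y' := by
  intro hlt
  have hp := h.isPeriod
  have hq := h'.isPeriod
  have hp1 := hp.1
  obtain ⟨⟨hxy, hyn, -, -, hend⟩, hlen, hpτ⟩ := h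
  obtain ⟨⟨hxy', hyn', -, -, -⟩, -, hqτ⟩ := h'
  have := hp.overlap_right hq (by omega) (by omega) (by omega)
  rw [show x + (y - x + 1) = y + 1 by omega] at this
  exact hend.elim (by omega) fun hne => hne this.symm

theorem end_unique (h : IsTauRun n T τ x y) (h' : IsTauRun n T τ x y') : y = y' :=
  le_antisymm (not_lt.1 (h'.not_lt_of_same_start h)) (not_lt.1 (h.not_lt_of_same_start h'))

theorem start_gap (h : IsTauRun n T τ x y) (h' : IsTauRun n T τ x' y') (hlt : x < x') :
    x + τ ≤ x' := by
  by_contra hgap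
  have hp := h.isPeriod
  have hq := h'.isPeriod
  have hp1 := hp.1
  obtain ⟨⟨hxy, hyn, -, -, -⟩, hlen, hpτ⟩ := h
  obtain ⟨⟨hxy', hyn', -, hstart, -⟩, hlen', hqτ⟩ := h'
  have hstart := hstart.resolve_left (by omega)
  obtain ⟨z, rfl⟩ : ∃ z, x' = z + 1 := ⟨x' - 1, by omega⟩
  exact hstart (hp.overlap_left hq (by omega) (by omega) (by omega))

end IsTauRun

open Classical in
theorem ncard_misperK_tauRuns_le {α : Type*} [DecidableEq α] (T : ℕ → α) {n τ k : ℕ}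
    (hτ : 1 ≤ τ) (hn : 2 * τ ≤ n) :
    {a : ℕ | ∃ x y, IsTauRun n T τ x y ∧
        a ∈ misperK k n T x (x + perOf T x (y - x + 1))}.Finite ∧
      τ * {a : ℕ | ∃ x y, IsTauRun n T τ x y ∧
        a ∈ misperK k n T x (x + perOf T x (y - x + 1))}.ncard ≤ 4 * n * k := by
  set X := (Finset.range n).filter fun x => ∃ y, IsTauRun n T τ x y with hX
  have hrun : ∀ x, ∃ y, x ∈ X → IsTauRun n T τ x y := fun x => by
    by_cases hx : x ∈ X
    · obtain ⟨y, hy⟩ := (Finset.mem_filter.1 hx).2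
      exact ⟨y, fun _ => hy⟩
    · exact ⟨0, fun h => absurd h hx⟩
  choose f hf using hrun
  set U := X.biUnion fun x => misperK k n T x (x + perOf T x (f x - x + 1)) with hU
  have hsub : {a : ℕ | ∃ x y, IsTauRun n T τ x y ∧
      a ∈ misperK k n T x (x + perOf T x (y - x + 1))} ⊆ (U : Set ℕ) := by
    rintro a ⟨x, y, hxy, ha⟩
    have hx : x ∈ X := Finset.mem_filter.2
      ⟨Finset.mem_range.2 (hxy.1.1.trans_lt hxy.1.2.1), y, hxy⟩
    rw [hxy.end_unique (hf x hx)] at ha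
    exact Finset.mem_coe.2 (Finset.mem_biUnion.2 ⟨x, hx, ha⟩)
  refine ⟨U.finite_toSet.subset hsub, ?_⟩
  have hle := Set.ncard_le_ncard hsub U.finite_toSet
  rw [Set.ncard_coe_finset] at hle
  have hXcard : X.card ≤ n / τ + 1 := card_le_of_gaps hτ X
    (fun x hx => Finset.mem_range.1 (Finset.mem_filter.1 hx).1)
    (fun x hx x' hx' hlt => (hf x hx).start_gap (hf x' hx') hlt)
  have hUcard : U.card ≤ X.card * (2 * k) :=
    Finset.card_biUnion_le_card_mul _ _ _ fun x _ => card_misperK_le k n T _ _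
  have hdiv : τ * (n / τ) ≤ n := Nat.mul_div_le _ _
  calc _ ≤ τ * ((n / τ + 1) * (2 * k)) :=
        Nat.mul_le_mul_left _ (hle.trans (hUcard.trans (Nat.mul_le_mul_right _ hXcard)))
    _ = (τ * (n / τ) + τ) * (2 * k) := by ring
    _ ≤ (2 * n) * (2 * k) := Nat.mul_le_mul_right _ (by omega)
    _ = 4 * n * k := by ring

/-- there is a constant `C > 0` such that for every string `T` of length `n`,
`k ≥ 1`, and `2 ≤ γ ≤ ⌊n/(k+1)⌋` with `τ = ⌊γ/3⌋` satisfying `1 ≤ τ` and `2τ ≤ n`: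
(i) `T` has a `τ`-synchronizing set `A1` with `|A1| ≤ C·n/γ`; and
(ii) the union `A2` of `Misper_{k+1}(T,x,x+p)` over all `τ`-runs `T[x..y]` (with
`p = per(T[x..y])`) is finite of size at most `C·n·k/γ`. -/
theorem stmt16 : ∃ C : ℝ, 0 < C ∧
    ∀ (α : Type) [DecidableEq α] (n k γ : ℕ) (T : ℕ → α),
      1 ≤ k → 2 ≤ γ → (k + 1) * γ ≤ n → 1 ≤ γ / 3 → 2 * (γ / 3) ≤ n →
      (∃ A1 : Finset ℕ, IsSyncSet n (γ / 3) T A1 ∧ (A1.card : ℝ) ≤ C * n / γ) ∧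
      ({a : ℕ | ∃ x y, IsTauRun n T (γ / 3) x y ∧
          a ∈ misperK (k + 1) n T x (x + perOf T x (y - x + 1))}.Finite ∧
        ({a : ℕ | ∃ x y, IsTauRun n T (γ / 3) x y ∧
          a ∈ misperK (k + 1) n T x (x + perOf T x (y - x + 1))}.ncard : ℝ) ≤
          C * n * k / γ) := by
  refine ⟨150, by norm_num, fun α _ n k γ T hk hγ hn hτ hτn => ?_⟩
  have hγτ : γ ≤ 5 * (γ / 3) := by omega
  have hγ0 : (0 : ℝ) < γ := by positivity
  refine ⟨?_, ?_⟩
  · obtain ⟨A, hA, hcard⟩ := exists_isSyncSet T hτ hτn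
    refine ⟨A, hA, ?_⟩
    have : A.card * γ ≤ 150 * n := by
      calc A.card * γ ≤ A.card * (5 * (γ / 3)) := Nat.mul_le_mul_left _ hγτ
        _ = 5 * (γ / 3 * A.card) := by ring
        _ ≤ 150 * n := by omega
    rw [le_div_iff₀ hγ0]
    exact_mod_cast this
  · obtain ⟨hfin, hcard⟩ := ncard_misperK_tauRuns_le (k := k + 1) T hτ hτn
    refine ⟨hfin, ?_⟩
    set N := {a : ℕ | ∃ x y, IsTauRun n T (γ / 3) x y ∧
      a ∈ misperK (k + 1) n T x (x + perOf T x (y - x + 1))}.ncard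
    have : N * γ ≤ 150 * n * k := by
      calc N * γ ≤ N * (5 * (γ / 3)) := Nat.mul_le_mul_left _ hγτ
        _ = 5 * (γ / 3 * N) := by ring
        _ ≤ 5 * (4 * n * (k + 1)) := Nat.mul_le_mul_left _ hcard
        _ ≤ 5 * (4 * n * (k + k)) := by gcongr
        _ = 40 * (n * k) := by ring
        _ ≤ 150 * (n * k) := Nat.mul_le_mul_right _ (by norm_num)
        _ = 150 * n * k := by ring
    rw [le_div_iff₀ hγ0]
    exact_mod_cast this
end
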